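/- Let (c^(N))_{N≥2} be a family of conductances satisfying condition (LLN). For each N, let g_N : {1,…,N} → ℝ satisfy Δ^{c^(N)} g_N = −gap_N·g_N and g_N(1) = 1, and let h_N(x) := cos(π·(x − 1/2)/N). Then lim_{N→∞} max_{1 ≤ x ≤ N} |g_N(x) − h_N(x)| = 0. -/

import Mathlib

open Filter Topology

/-- The generator `Δ^c` of the random walk with conductances `c` on `⟦1, N⟧`. -/
def gen (N : ℕ) (c : ℕ → ℝ) (f : ℕ → ℝ) (x : ℕ) : ℝ :=
  (if x < N then c x * (f (x + 1) - f x) else 0) +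
  (if 2 ≤ x then c (x - 1) * (f (x - 1) - f x) else 0)

/-- `lam` is an eigenvalue of `−Δ^c`. -/
def IsEigenvalue (N : ℕ) (c : ℕ → ℝ) (lam : ℝ) : Prop :=
  ∃ f : ℕ → ℝ, (∃ x ∈ Finset.Icc 1 N, f x ≠ 0) ∧
    ∀ x ∈ Finset.Icc 1 N, gen N c f x = -lam * f x

/-- The spectral gap: the smallest strictly positive eigenvalue of `−Δ^c`. -/
noncomputable def spectralGap (N : ℕ) (c : ℕ → ℝ) : ℝ :=
  sInf {lam : ℝ | 0 < lam ∧ IsEigenvalue N c lam}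

/-- `rsum r n m = Σ_{x=n}^{m-1} r(x)`. -/
def rsum (r : ℕ → ℝ) (n m : ℕ) : ℝ := ∑ x ∈ Finset.Ico n m, r x

/-- Condition (LLN): `(1/N)·sup_{1 ≤ n < m ≤ N} |r^{(N)}(n,m) − (m−n)| → 0`. -/
def LLN (r : ℕ → ℕ → ℝ) : Prop :=
  ∀ ε > (0 : ℝ), ∃ N₀ : ℕ, ∀ N ≥ N₀, ∀ n m : ℕ, 1 ≤ n → n < m → m ≤ N →
    |rsum (r N) n m - ((m : ℝ) - (n : ℝ))| ≤ ε * N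


/-- `h_N(x) = cos(π(x − 1/2)/N)`. -/
noncomputable def hfun (N : ℕ) (x : ℕ) : ℝ := Real.cos (Real.pi * ((x : ℝ) - 1/2) / N)


/-- zero-indexed recursion -/
def Recu (N : ℕ) (ρ : ℕ → ℝ) (lam : ℝ) (F : ℕ → ℝ) : Prop :=
  ∀ k, k + 1 < N → F (k + 1) = F k - lam * ρ k * ∑ j ∈ Finset.range (k + 1), F j

lemma gronwall_aux (N : ℕ) (ρ d : ℕ → ℝ) (a lam : ℝ) (hρ : ∀ k, 0 ≤ ρ k) (ha : 0 ≤ a)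
    (hl : 0 ≤ lam)
    (h : ∀ k < N, |d k| ≤ a + lam * ∑ j ∈ Finset.range k, ρ j * |∑ i ∈ Finset.range (j + 1), d i|) :
    ∀ k < N, |d k| ≤ a * ∏ j ∈ Finset.range k, (1 + lam * N * ρ j) := by
  have hP : ∀ k, a * ∏ j ∈ Finset.range k, (1 + lam * N * ρ j) = a + lam * ∑ j ∈ Finset.range k,
      ρ j * (N * (a * ∏ i ∈ Finset.range j, (1 + lam * N * ρ i))) := by
    intro k
    induction k with
    | zero => simp
    | succ k ih => 
      rw [Finset.prod_range_succ, Finset.sum_range_succ]; linear_combination ih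
  have hpos : ∀ j, 0 ≤ lam * N * ρ j := fun j => mul_nonneg (mul_nonneg hl (Nat.cast_nonneg _)) (hρ j)
  have hmono : Monotone fun k => a * ∏ j ∈ Finset.range k, (1 + lam * N * ρ j) := by
    apply monotone_nat_of_le_succ
    intro n
    apply mul_le_mul_of_nonneg_left _ ha
    rw [Finset.prod_range_succ]
    apply le_mul_of_one_le_right
    · exact Finset.prod_nonneg fun i _ => by linarith [hpos i]
    · linarith [hpos n]
  intro k
  induction k using Nat.strong_induction_on with
  | _ k ih =>
    intro hk
    refine (h k hk).trans ?_
    rw [hP k]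
    gcongr with j hj
    · exact hρ j
    have hj := Finset.mem_range.1 hj
    refine (Finset.abs_sum_le_sum_abs _ _).trans ?_
    have : ∑ i ∈ Finset.range (j + 1), |d i| ≤ ∑ i ∈ Finset.range (j+1),
        (a * ∏ i ∈ Finset.range j, (1 + lam * N * ρ i)) := by
      apply Finset.sum_le_sum
      intro i hi
      have hi := Finset.mem_range.1 hi
      exact (ih i (by omega) (by omega)).trans (hmono (by omega : i ≤ j))
    refine this.trans ?_
    rw [Finset.sum_const, Finset.card_range, nsmul_eq_mul]
    apply mul_le_mul_of_nonneg_right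
    · exact_mod_cast (by omega : j + 1 ≤ N)
    · exact mul_nonneg ha (Finset.prod_nonneg fun i _ => by linarith [hpos i])

lemma cos_sum (θ : ℝ) (k : ℕ) :
    2 * Real.sin (θ/2) * ∑ j ∈ Finset.range k, Real.cos (θ * (j + 1/2)) = Real.sin (θ * k) := by
  induction k with
  | zero => simp
  | succ k ih =>
    rw [Finset.sum_range_succ, mul_add, ih]
    push_cast
    have e1 : θ * ((k:ℝ) + 1) = θ * (k + 1/2) + θ/2 := by ring
    have e2 : θ * (k:ℝ) = θ * (k + 1/2) - θ/2 := by ring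
    rw [e1, e2, Real.sin_add, Real.sin_sub]; ring

lemma cos_recu (θ : ℝ) (k : ℕ) :
    Real.cos (θ * ((k + 1 : ℕ) + 1/2)) = Real.cos (θ * (k + 1/2)) - 4 * Real.sin (θ/2)^2 *
      ∑ j ∈ Finset.range (k+1), Real.cos (θ * (j + 1/2)) := by
  have := cos_sum θ (k+1)
  push_cast at this ⊢
  have e1 : θ * ((k:ℝ) + 1 + 1/2) = θ * (k + 1) + θ/2 := by ring
  have e2 : θ * ((k:ℝ) + 1/2) = θ * (k + 1) - θ/2 := by ring
  have e3 : 4 * Real.sin (θ/2)^2 * ∑ j ∈ Finset.range (k+1), Real.cos (θ * (j + 1/2))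
    = 2 * Real.sin (θ/2) * Real.sin (θ * (k+1)) := by rw [← this]; ring
  rw [e3, e1, e2, Real.cos_add, Real.cos_sub]; ring

lemma abel_aux (R H h : ℕ → ℝ) (hH : ∀ k, H (k+1) = H k + h (k+1)) (k : ℕ) :
    ∑ j ∈ Finset.range k, (R (j+1) - R j) * H j =
      R k * H k - R 0 * H 0 - ∑ j ∈ Finset.range k, R (j+1) * h (j+1) := by
  induction k with
  | zero => simp
  | succ k ih => rw [Finset.sum_range_succ, Finset.sum_range_succ, ih, hH]; ring

lemma core (N : ℕ) (hN : 1 ≤ N) (ρ F : ℕ → ℝ) (ε θ : ℝ) (hρ : ∀ k, 0 ≤ ρ k)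
    (hε0 : 0 ≤ ε) (hε : ε ≤ 1) (hθ : 0 ≤ θ) (hNθ : N * θ ≤ 4)
    (hR : ∀ k < N, |∑ j ∈ Finset.range k, (ρ j - 1)| ≤ ε * N)
    (hF : Recu N ρ (4 * Real.sin (θ/2)^2) F) (hF0 : F 0 = 1) :
    ∀ k < N, |F k - Real.cos (θ * (k + 1/2))| ≤ (2 / N + 32 * ε) * Real.exp 32 := by
  set lam := 4 * Real.sin (θ/2)^2 with hlam
  have hN0 : (1:ℝ) ≤ N := by exact_mod_cast hN
  have hl0 : 0 ≤ lam := by positivity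
  have hl1 : lam ≤ θ^2 := by
    have : Real.sin (θ/2)^2 ≤ (θ/2)^2 := by
      rw [sq_le_sq]; exact Real.abs_sin_le_abs
    rw [hlam]; linarith
  have hNt2 : N^2 * θ^2 ≤ 16 := by
    have : 0 ≤ N * θ := by positivity
    nlinarith
  have hl2 : N^2 * lam ≤ 16 := by
    refine le_trans ?_ hNt2
    gcongr
  set h : ℕ → ℝ := fun k => Real.cos (θ * (k + 1/2)) with hh
  set H : ℕ → ℝ := fun k => ∑ j ∈ Finset.range (k+1), h j with hHdef
  set R : ℕ → ℝ := fun k => ∑ j ∈ Finset.range k, (ρ j - 1) with hRdef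
  have hhr : ∀ k, h (k+1) = h k - lam * H k := fun k => cos_recu θ k
  set d : ℕ → ℝ := fun k => F k - h k with hd
  have hdk : ∀ k < N, d k = d 0 - lam * ∑ j ∈ Finset.range k, ρ j * ∑ i ∈ Finset.range (j+1), d i
      - lam * ∑ j ∈ Finset.range k, (R (j+1) - R j) * H j := by
    intro k
    induction k with
    | zero => simp
    | succ k ih =>
      intro hk
      have ih := ih (by omega)
      have h1 := hF k hk
      have h2 := hhr k
      have h3 : ∑ i ∈ Finset.range (k+1), d i = ∑ i ∈ Finset.range (k+1), F i - H k := by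
        simp [hd, hHdef, Finset.sum_sub_distrib]
      have h4 : R (k+1) - R k = ρ k - 1 := by
        simp only [hRdef]; rw [Finset.sum_range_succ]; ring
      rw [Finset.sum_range_succ (fun j => ρ j * _) k, Finset.sum_range_succ (fun j => _ * H j) k, h3, h4]
      have : d (k+1) = d k - lam * ρ k * ∑ j ∈ Finset.range (k + 1), F j + lam * H k := by
        simp only [hd]; rw [h1, h2]; ring
      rw [this, ih]; ring
  have hhabs : ∀ k, |h k| ≤ 1 := fun k => Real.abs_cos_le_one _
  have hHabs : ∀ k < N, |H k| ≤ N := by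
    intro k hk
    refine (Finset.abs_sum_le_sum_abs _ _).trans ?_
    refine (Finset.sum_le_sum fun i _ => hhabs i).trans ?_
    simp
    exact_mod_cast (by omega : k + 1 ≤ N)
  have hab : ∀ k < N, |∑ j ∈ Finset.range k, (R (j+1) - R j) * H j| ≤ 2 * ε * N^2 := by
    intro k hk
    rw [abel_aux R H h (fun k => by simp only [hHdef]; rw [Finset.sum_range_succ _ (k+1)])]
    have hR0 : R 0 = 0 := by simp [hRdef]
    rw [hR0, zero_mul, sub_zero]
    have b1 : |R k * H k| ≤ ε * N * N := by
      rw [abs_mul]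
      exact mul_le_mul (hR k hk) (hHabs k hk) (abs_nonneg _) (by positivity)
    have b2 : |∑ j ∈ Finset.range k, R (j+1) * h (j+1)| ≤ N * (ε * N) := by
      refine (Finset.abs_sum_le_sum_abs _ _).trans ?_
      have : ∑ j ∈ Finset.range k, |R (j+1) * h (j+1)| ≤ ∑ j ∈ Finset.range k, (ε * N) := by
        apply Finset.sum_le_sum
        intro j hj
        have hj := Finset.mem_range.1 hj
        rw [abs_mul]
        calc _ ≤ (ε * N) * 1 := mul_le_mul (hR (j+1) (by omega)) (hhabs _) (abs_nonneg _) (by positivity)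
          _ = _ := by ring
      refine this.trans ?_
      rw [Finset.sum_const, Finset.card_range, nsmul_eq_mul]
      have : (k:ℝ) ≤ N := by exact_mod_cast hk.le
      gcongr
    have := abs_sub (R k * H k) (∑ j ∈ Finset.range k, R (j+1) * h (j+1))
    nlinarith
  have hd0 : |d 0| ≤ 2 / N := by
    have e : d 0 = 1 - Real.cos (θ/2) := by
      simp only [hd, hh, hF0]; norm_num; ring_nf
    rw [e, abs_of_nonneg (by linarith [Real.cos_le_one (θ/2)])]
    have := Real.one_sub_sq_div_two_le_cos (x := θ/2)
    have h5 : 2 / (N:ℝ) ≥ 2 / N^2 := by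
      gcongr
      nlinarith
    have h6 : θ^2 / 8 ≤ 2 / N^2 := by
      rw [le_div_iff₀ (by positivity)]; linarith
    linarith
  set a := 2 / N + 32 * ε with hadef
  have ha : 0 ≤ a := by positivity
  have key := gronwall_aux N ρ d a lam hρ ha hl0 (by
    intro k hk
    rw [hdk k hk]
    have t1 := abs_sub (d 0 - lam * ∑ j ∈ Finset.range k, ρ j * ∑ i ∈ Finset.range (j+1), d i)
      (lam * ∑ j ∈ Finset.range k, (R (j+1) - R j) * H j)
    have t2 := abs_sub (d 0) (lam * ∑ j ∈ Finset.range k, ρ j * ∑ i ∈ Finset.range (j+1), d i)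
    have t3 : |lam * ∑ j ∈ Finset.range k, (R (j+1) - R j) * H j| ≤ 32 * ε := by
      rw [abs_mul, abs_of_nonneg hl0]
      calc _ ≤ lam * (2 * ε * N^2) := by gcongr; exact hab k hk
        _ = (2 * ε) * (N^2 * lam) := by ring
        _ ≤ (2 * ε) * 16 := by gcongr
        _ = _ := by ring
    have t4 : |lam * ∑ j ∈ Finset.range k, ρ j * ∑ i ∈ Finset.range (j+1), d i| ≤
        lam * ∑ j ∈ Finset.range k, ρ j * |∑ i ∈ Finset.range (j+1), d i| := by
      rw [abs_mul, abs_of_nonneg hl0]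
      gcongr
      refine (Finset.abs_sum_le_sum_abs _ _).trans (le_of_eq ?_)
      apply Finset.sum_congr rfl
      intro j _
      rw [abs_mul, abs_of_nonneg (hρ j)]
    linarith)
  intro k hk
  refine (key k hk).trans ?_
  gcongr
  have hsum : ∑ j ∈ Finset.range k, ρ j ≤ 2 * N := by
    have h1 := (abs_le.1 (hR k hk)).2
    rw [Finset.sum_sub_distrib] at h1
    simp at h1
    have : (k:ℝ) ≤ N := by exact_mod_cast hk.le
    nlinarith
  calc _ ≤ ∏ j ∈ Finset.range k, Real.exp (lam * N * ρ j) := by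
        apply Finset.prod_le_prod
        · intro i _
          have := hρ i
          positivity
        · intro i _
          linarith [Real.add_one_le_exp (lam * N * ρ i)]
    _ = Real.exp (lam * N * ∑ j ∈ Finset.range k, ρ j) := by
        rw [← Real.exp_sum, Finset.mul_sum]
    _ ≤ _ := by
        apply Real.exp_le_exp.2
        calc _ ≤ lam * N * (2 * N) := by gcongr
          _ = 2 * (N^2 * lam) := by ring
          _ ≤ 32 := by linarith

/-- shooting solution together with its partial sums -/
noncomputable def shoot (ρ : ℕ → ℝ) (lam : ℝ) : ℕ → ℝ × ℝ
  | 0 => (1, 1)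
  | k + 1 => ((shoot ρ lam k).1 - lam * ρ k * (shoot ρ lam k).2,
      (shoot ρ lam k).2 + ((shoot ρ lam k).1 - lam * ρ k * (shoot ρ lam k).2))

lemma shoot_sum (ρ : ℕ → ℝ) (lam : ℝ) (k : ℕ) :
    (shoot ρ lam k).2 = ∑ j ∈ Finset.range (k+1), (shoot ρ lam j).1 := by
  induction k with
  | zero => simp [shoot]
  | succ k ih => rw [Finset.sum_range_succ, ← ih]; simp [shoot]

lemma shoot_recu (N : ℕ) (ρ : ℕ → ℝ) (lam : ℝ) : Recu N ρ lam (fun k => (shoot ρ lam k).1) := by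
  intro k _
  simp only
  rw [← shoot_sum]; simp [shoot]

lemma shoot_cont (ρ : ℕ → ℝ) (k : ℕ) : Continuous (fun lam => shoot ρ lam k) := by
  induction k with
  | zero => simp only [shoot]; fun_prop
  | succ k ih => simp only [shoot]; fun_prop

lemma gen_flux (N : ℕ) (c f : ℕ → ℝ) (lam : ℝ)
    (h : ∀ x ∈ Finset.Icc 1 N, gen N c f x = -lam * f x) :
    ∀ k, k < N → (if k + 1 < N then c (k+1) * (f (k+2) - f (k+1)) else 0) =
      -lam * ∑ j ∈ Finset.range (k+1), f (j+1) := by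
  intro k
  induction k with
  | zero =>
    intro hk
    have := h 1 (by simp; omega)
    simpa [gen] using this
  | succ k ih =>
    intro hk
    have ih := ih (by omega)
    have := h (k+2) (by simp; omega)
    simp only [gen] at this
    rw [if_pos (by omega : 2 ≤ k+2)] at this
    rw [if_pos hk] at ih
    rw [Finset.sum_range_succ, mul_add, ← ih, ← this]
    simp only [show k + 2 - 1 = k + 1 from rfl, show k + 1 + 1 = k + 2 from rfl,
      show k + 1 + 2 = k + 2 + 1 from rfl]
    ring

lemma gen_recu (N : ℕ) (c f : ℕ → ℝ) (lam : ℝ) (hc : ∀ x, 1 ≤ x → x ≤ N - 1 → 0 < c x)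
    (h : ∀ x ∈ Finset.Icc 1 N, gen N c f x = -lam * f x) :
    Recu N (fun k => |1 / c (k+1)|) lam (fun k => f (k+1)) := by
  intro k hk
  have h1 := gen_flux N c f lam h k (by omega)
  rw [if_pos hk] at h1
  have hcp := hc (k+1) (by omega) (by omega)
  simp only
  rw [abs_of_pos (by positivity)]
  have h2 : f (k+2) - f (k+1) = (1 / c (k+1)) * (-lam * ∑ j ∈ Finset.range (k+1), f (j+1)) := by
    rw [← h1]; field_simp
  show f (k+2) = _
  linear_combination h2

lemma recu_gen (N : ℕ) (c F : ℕ → ℝ) (lam : ℝ) (hN : 1 ≤ N)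
    (hc : ∀ x, 1 ≤ x → x ≤ N - 1 → 0 < c x)
    (hF : Recu N (fun k => |1 / c (k+1)|) lam F)
    (hS : ∑ j ∈ Finset.range N, F j = 0) :
    ∀ x ∈ Finset.Icc 1 N, gen N c (fun x => F (x-1)) x = -lam * F (x-1) := by
  have flux : ∀ k, k + 1 < N → c (k+1) * (F (k+1) - F k) = -lam * ∑ j ∈ Finset.range (k+1), F j := by
    intro k hk
    have hcp := hc (k+1) (by omega) (by omega)
    have := hF k hk
    simp only at this
    rw [abs_of_pos (by positivity)] at this
    rw [this]; field_simp; ring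
  have flux2 : ∀ k, k + 1 ≤ N → (if k+1 < N then c (k+1) * (F (k+1) - F k) else 0) =
      -lam * ∑ j ∈ Finset.range (k+1), F j := by
    intro k hk
    split_ifs with h
    · exact flux k h
    · rw [show k + 1 = N by omega, hS]; simp
  intro x hx
  rw [Finset.mem_Icc] at hx
  obtain ⟨k, rfl⟩ : ∃ k, x = k + 1 := ⟨x - 1, by omega⟩
  simp only [gen, Nat.add_sub_cancel]
  rw [flux2 k hx.2]
  rcases k with _ | k
  · simp
  · rw [if_pos (by omega)]
    have := flux k (by omega)
    simp only [Nat.add_sub_cancel]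
    rw [Finset.sum_range_succ]
    linear_combination -this

lemma theta_exists (a b lam : ℝ) (hab : a ≤ b)
    (h1 : 4 * Real.sin (a/2)^2 ≤ lam) (h2 : lam ≤ 4 * Real.sin (b/2)^2) :
    ∃ θ, a ≤ θ ∧ θ ≤ b ∧ lam = 4 * Real.sin (θ/2)^2 := by
  have hc : ContinuousOn (fun t : ℝ => 4 * Real.sin (t/2)^2) (Set.Icc a b) := by fun_prop
  obtain ⟨t, ht, he⟩ := intermediate_value_Icc hab hc ⟨h1, h2⟩
  exact ⟨t, ht.1, ht.2, he.symm⟩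

lemma sum_close (N : ℕ) (F : ℕ → ℝ) (θ η : ℝ)
    (h : ∀ k < N, |F k - Real.cos (θ * (k + 1/2))| ≤ η) :
    |∑ j ∈ Finset.range N, F j - ∑ j ∈ Finset.range N, Real.cos (θ * (j + 1/2))| ≤ N * η := by
  rw [← Finset.sum_sub_distrib]
  refine (Finset.abs_sum_le_sum_abs _ _).trans ?_
  refine (Finset.sum_le_sum fun i hi => h i (Finset.mem_range.1 hi)).trans ?_
  simp

lemma cos_sum_pos (N : ℕ) (hN : 2 ≤ N) (θ δ : ℝ) (hδ : 0 < δ) (hδ' : δ ≤ 1/2) (hθ : 0 < θ)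
    (hs : N * θ ≤ Real.pi - δ) :
    N * (Real.sin δ / 4) ≤ ∑ j ∈ Finset.range N, Real.cos (θ * (j + 1/2)) := by
  have hpi := Real.pi_gt_three
  have hpi' := Real.pi_lt_d2
  have hN2 : (2:ℝ) ≤ N := by exact_mod_cast hN
  have h1 := cos_sum θ N
  set C := ∑ j ∈ Finset.range N, Real.cos (θ * (j + 1/2))
  have hθ2 : θ ≤ 2 := by nlinarith
  have hsp : 0 < Real.sin (θ/2) := Real.sin_pos_of_pos_of_lt_pi (by linarith) (by linarith)
  have hsl : Real.sin (θ/2) ≤ θ/2 := Real.sin_le (by linarith)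
  have hsd : 0 < Real.sin δ := Real.sin_pos_of_pos_of_lt_pi hδ (by linarith)
  have hconc : θ * N * (Real.sin δ / 4) ≤ Real.sin (θ * N) := by
    have hq : θ * (N:ℝ) / (Real.pi - δ) ≤ 1 := by
      rw [div_le_one (by linarith)]; linarith
    have hq0 : 0 ≤ θ * (N:ℝ) / (Real.pi - δ) := div_nonneg (by positivity) (by linarith)
    have m1 : (0:ℝ) ∈ Set.Icc 0 Real.pi := ⟨le_refl _, by linarith⟩
    have m2 : Real.pi - δ ∈ Set.Icc 0 Real.pi := ⟨by linarith, by linarith⟩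
    have hcc := strictConcaveOn_sin_Icc.concaveOn.2 m1 m2 (sub_nonneg.2 hq) hq0 (by ring)
    simp only [smul_eq_mul, mul_zero, zero_add, Real.sin_zero, Real.sin_pi_sub] at hcc
    rw [div_mul_cancel₀ _ (by linarith : (0:ℝ) < Real.pi - δ).ne'] at hcc
    refine le_trans ?_ hcc
    have : θ * N * (Real.sin δ / 4) = θ * N / 4 * Real.sin δ := by ring
    rw [this]
    gcongr
    · linarith
    · linarith
  have : 2 * Real.sin (θ/2) * (N * (Real.sin δ / 4)) ≤ 2 * Real.sin (θ/2) * C := by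
    rw [h1]
    refine le_trans ?_ hconc
    calc _ ≤ θ * (N * (Real.sin δ / 4)) := by
          gcongr; linarith
      _ = _ := by ring
  exact le_of_mul_le_mul_left this (by linarith)

lemma cos_sum_neg (N : ℕ) (hN : 2 ≤ N) (θ δ : ℝ) (hδ : 0 < δ) (hδ' : δ ≤ 1/2)
    (hs : N * θ = Real.pi + δ) :
    ∑ j ∈ Finset.range N, Real.cos (θ * (j + 1/2)) ≤ - (N * (Real.sin δ / 4)) := by
  have hpi := Real.pi_gt_three
  have hpi' := Real.pi_lt_d2
  have hN2 : (2:ℝ) ≤ N := by exact_mod_cast hN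
  have h1 := cos_sum θ N
  set C := ∑ j ∈ Finset.range N, Real.cos (θ * (j + 1/2))
  have hθ : 0 < θ := by
    by_contra hh
    nlinarith
  have hθ2 : θ ≤ 2 := by nlinarith
  have hsp : 0 < Real.sin (θ/2) := Real.sin_pos_of_pos_of_lt_pi (by linarith) (by linarith)
  have hsl : Real.sin (θ/2) ≤ θ/2 := Real.sin_le (by linarith)
  have hsd : 0 < Real.sin δ := Real.sin_pos_of_pos_of_lt_pi hδ (by linarith)
  rw [mul_comm θ, hs, add_comm, Real.sin_add_pi] at h1
  have hC : C < 0 := by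
    by_contra hh
    push Not at hh
    have : 0 ≤ 2 * Real.sin (θ/2) * C := by positivity
    linarith
  have h2 : Real.sin δ ≤ θ * (-C) := by
    have : 2 * Real.sin (θ/2) * (-C) ≤ θ * (-C) := by
      apply mul_le_mul_of_nonneg_right <;> linarith
    linarith
  have h3 : N * Real.sin δ ≤ 4 * (-C) := by
    calc N * Real.sin δ ≤ N * (θ * (-C)) := by gcongr
      _ = (N * θ) * (-C) := by ring
      _ ≤ 4 * (-C) := by
        apply mul_le_mul_of_nonneg_right <;> linarith
  linarith

lemma perN (N : ℕ) (hN : 2 ≤ N) (c : ℕ → ℝ) (hc : ∀ x, 1 ≤ x → x ≤ N - 1 → 0 < c x)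
    (ε δ : ℝ) (hε0 : 0 ≤ ε) (hε : ε ≤ 1) (hδ : 0 < δ) (hδ' : δ ≤ 1/2)
    (hη : (2 / N + 32 * ε) * Real.exp 32 < Real.sin δ / 4)
    (hR : ∀ k < N, |∑ j ∈ Finset.range k, (|1 / c (j+1)| - 1)| ≤ ε * N) :
    ∃ θ, (Real.pi - δ) / N ≤ θ ∧ θ ≤ (Real.pi + δ) / N ∧
      spectralGap N c = 4 * Real.sin (θ/2)^2 := by
  have hpi := Real.pi_gt_three
  have hpi' := Real.pi_lt_d2
  have hN2 : (2:ℝ) ≤ N := by exact_mod_cast hN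
  have hNpos : (0:ℝ) < N := by linarith
  set ρ : ℕ → ℝ := fun k => |1 / c (k+1)| with hρd
  set η := (2 / N + 32 * ε) * Real.exp 32
  have hρ : ∀ k, 0 ≤ ρ k := fun k => abs_nonneg _
  set θm := (Real.pi - δ) / N with hm
  set θp := (Real.pi + δ) / N with hp
  have hNm : N * θm = Real.pi - δ := by rw [hm]; field_simp
  have hNp : N * θp = Real.pi + δ := by rw [hp]; field_simp
  have hm0 : 0 < θm := div_pos (by linarith) hNpos
  have hmp : θm ≤ θp := by rw [hm, hp]; gcongr; linarith
  have hp2 : θp ≤ 2 := by nlinarith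
  have hpos : ∀ θ F, 0 < θ → θ ≤ θm → Recu N ρ (4 * Real.sin (θ/2)^2) F → F 0 = 1 →
      0 < ∑ j ∈ Finset.range N, F j := by
    intro θ F h0 h1 hF hF0
    have hb : N * θ ≤ Real.pi - δ := by rw [← hNm]; gcongr
    have h2 := sum_close N F θ η (core N (by omega) ρ F ε θ hρ hε0 hε h0.le (by linarith) hR hF hF0)
    have h3 := cos_sum_pos N hN θ δ hδ hδ' h0 hb
    have h4 := (abs_le.1 h2).1
    nlinarith
  have hneg : ∀ F, Recu N ρ (4 * Real.sin (θp/2)^2) F → F 0 = 1 →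
      ∑ j ∈ Finset.range N, F j < 0 := by
    intro F hF hF0
    have h2 := sum_close N F θp η
      (core N (by omega) ρ F ε θp hρ hε0 hε (by linarith) (by linarith) hR hF hF0)
    have h3 := cos_sum_neg N hN θp δ hδ hδ' hNp
    have h4 := (abs_le.1 h2).2
    nlinarith
  set lm := 4 * Real.sin (θm/2)^2 with hlm
  set lp := 4 * Real.sin (θp/2)^2 with hlp
  have hsm : 0 < Real.sin (θm/2) := Real.sin_pos_of_pos_of_lt_pi (by linarith) (by linarith)
  have hlm0 : 0 < lm := by positivity
  have hlmp : lm ≤ lp := by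
    have : Real.sin (θm/2) ≤ Real.sin (θp/2) :=
      Real.sin_le_sin_of_le_of_le_pi_div_two (by linarith) (by linarith) (by linarith)
    rw [hlm, hlp]; gcongr
  have hsh : ∀ lam, (shoot ρ lam (N-1)).2 = ∑ j ∈ Finset.range N, (shoot ρ lam j).1 := by
    intro lam
    rw [shoot_sum, show N - 1 + 1 = N by omega]
  -- existence
  obtain ⟨l0, hl0, hl0e⟩ : ∃ l0 ∈ Set.Icc lm lp, (shoot ρ l0 (N-1)).2 = 0 := by
    have hcont : ContinuousOn (fun lam => (shoot ρ lam (N-1)).2) (Set.Icc lm lp) :=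
      ((shoot_cont ρ (N-1)).snd).continuousOn
    have := intermediate_value_Icc' hlmp hcont
    obtain ⟨t, ht, he⟩ := this (show (0:ℝ) ∈ _ from
      ⟨by rw [hsh]; exact (hneg _ (shoot_recu N ρ lp) rfl).le,
       by rw [hsh]; exact (hpos θm _ hm0 le_rfl (shoot_recu N ρ lm) rfl).le⟩)
    exact ⟨t, ht, he⟩
  have hmem : l0 ∈ {lam : ℝ | 0 < lam ∧ IsEigenvalue N c lam} := by
    refine ⟨lt_of_lt_of_le hlm0 hl0.1, fun x => (shoot ρ l0 (x-1)).1, ⟨1, by simp; omega, ?_⟩, ?_⟩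
    · simp [shoot]
    · exact recu_gen N c (fun k => (shoot ρ l0 k).1) l0 (by omega) hc (shoot_recu N ρ l0)
        (by rw [← hsh]; exact hl0e)
  have hlow : ∀ lam ∈ {lam : ℝ | 0 < lam ∧ IsEigenvalue N c lam}, lm ≤ lam := by
    rintro lam ⟨hlam, f, ⟨x, hx, hfx⟩, hf⟩
    by_contra hlt
    push Not at hlt
    obtain ⟨θ, h0, h1, he⟩ := theta_exists 0 θm lam hm0.le (by simpa using hlam.le) hlt.le
    have hθ0 : 0 < θ := by
      rcases h0.lt_or_eq with h | h
      · exact h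
      · rw [← h] at he; simp at he; linarith
    have hrec := gen_recu N c f lam hc hf
    have hS : ∑ j ∈ Finset.range N, f (j+1) = 0 := by
      have := gen_flux N c f lam hf (N-1) (by omega)
      rw [if_neg (by omega), show N - 1 + 1 = N by omega] at this
      have h := mul_eq_zero.1 this.symm
      rcases h with h | h
      · linarith
      · exact h
    have hf1 : f 1 ≠ 0 := by
      intro hf1
      have hz : ∀ k, k < N → f (k+1) = 0 := by
        intro k
        induction k using Nat.strong_induction_on with
        | _ k ih =>
          intro hk
          rcases k with _ | k
          · simpa using hf1
          · have := hrec k hk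
            simp only at this
            rw [this, ih k (by omega) (by omega), Finset.sum_eq_zero]
            · simp
            · intro j hj
              have := Finset.mem_range.1 hj
              exact ih j (by omega) (by omega)
      rw [Finset.mem_Icc] at hx
      apply hfx
      have := hz (x-1) (by omega)
      rwa [show x - 1 + 1 = x by omega] at this
    have := hpos θ (fun k => f (k+1) / f 1) hθ0 h1 (by
      rw [← he]
      intro k hk
      have := hrec k hk
      simp only at this ⊢
      rw [this, ← Finset.sum_div]; ring) (by simp [hf1])
    rw [← Finset.sum_div, hS] at this
    simp at this
  apply theta_exists θm θp _ hmp
  · exact le_csInf ⟨l0, hmem⟩ hlow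
  · exact (csInf_le ⟨lm, hlow⟩ hmem).trans hl0.2

/-- Under condition (LLN), the principal eigenfunction `g_N` with `g_N(1) = 1`
satisfies `max_{1 ≤ x ≤ N} |g_N(x) − h_N(x)| → 0`. -/
theorem eigenfunction_shape (c : ℕ → ℕ → ℝ) (g : ℕ → ℕ → ℝ)
    (hc : ∀ N, 2 ≤ N → ∀ x, 1 ≤ x → x ≤ N - 1 → 0 < c N x)
    (hLLN : LLN (fun N x => 1 / c N x))
    (hg : ∀ N, 2 ≤ N → ∀ x ∈ Finset.Icc 1 N,
      gen N (c N) (g N) x = -(spectralGap N (c N)) * g N x)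
    (hg1 : ∀ N, 2 ≤ N → g N 1 = 1) :
    ∀ ε > (0 : ℝ), ∃ N₀ : ℕ, ∀ N ≥ N₀, ∀ x ∈ Finset.Icc 1 N,
      |g N x - hfun N x| < ε := by
  intro ε hε
  have hpi := Real.pi_gt_three
  have hpi' := Real.pi_lt_d2
  obtain ⟨δ, hδ, hδ', hδε⟩ : ∃ δ : ℝ, 0 < δ ∧ δ ≤ 1/2 ∧ δ ≤ ε/2 :=
    ⟨min (1/2) (ε/2), by positivity, min_le_left _ _, min_le_right _ _⟩
  have hsd : 0 < Real.sin δ := Real.sin_pos_of_pos_of_lt_pi hδ (by linarith)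
  obtain ⟨κ, hκ, hκ1, hκ2⟩ : ∃ κ : ℝ, 0 < κ ∧ κ < Real.sin δ / 4 ∧ κ < ε/2 := by
    obtain ⟨κ, h1, h2⟩ := exists_between (show 0 < min (Real.sin δ / 4) (ε/2) by positivity)
    exact ⟨κ, h1, lt_of_lt_of_le h2 (min_le_left _ _), lt_of_lt_of_le h2 (min_le_right _ _)⟩
  have hE := Real.exp_pos 32
  set E := Real.exp 32 with hEd
  obtain ⟨e, he0, he1, he2⟩ : ∃ e : ℝ, 0 < e ∧ e ≤ 1 ∧ e ≤ κ / (64 * E) :=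
    ⟨min 1 (κ / (64 * E)), by positivity, min_le_left _ _, min_le_right _ _⟩
  obtain ⟨N1, hN1⟩ := hLLN e he0
  obtain ⟨N2, hN2⟩ := exists_nat_gt (4 * E / κ)
  refine ⟨max 2 (max N1 N2), fun N hN x hx => ?_⟩
  have hNa : 2 ≤ N := (le_max_left _ _).trans hN
  have hNb : N1 ≤ N := (le_max_left _ _).trans ((le_max_right _ _).trans hN)
  have hNc : N2 ≤ N := (le_max_right _ _).trans ((le_max_right _ _).trans hN)
  have hN2' : (2:ℝ) ≤ N := by exact_mod_cast hNa
  have hNpos : (0:ℝ) < N := by linarith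
  have hη : (2 / N + 32 * e) * E ≤ κ := by
    have h1 : 4 * E / κ ≤ N := hN2.le.trans (by exact_mod_cast hNc)
    have h2 : 2 / N * E ≤ κ / 2 := by
      rw [div_le_iff₀ hκ] at h1
      rw [div_mul_eq_mul_div, div_le_iff₀ hNpos]; linarith
    rw [le_div_iff₀ (by positivity)] at he2
    nlinarith
  have hcN := hc N hNa
  have hR : ∀ k < N, |∑ j ∈ Finset.range k, (|1 / c N (j+1)| - 1)| ≤ e * N := by
    intro k hk
    rcases Nat.eq_zero_or_pos k with rfl | hk0
    · simp; positivity
    · have := hN1 N hNb 1 (k+1) le_rfl (by omega) (by omega)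
      rw [rsum, Finset.sum_Ico_eq_sum_range] at this
      convert this using 2
      rw [Finset.sum_sub_distrib]
      simp only [Nat.add_sub_cancel, Finset.sum_const, Finset.card_range, nsmul_eq_mul]
      push_cast
      congr 1
      · apply Finset.sum_congr rfl
        intro j hj
        have := Finset.mem_range.1 hj
        have hcp := hcN (j+1) (by omega) (by omega)
        rw [abs_of_pos (by positivity), add_comm 1 j]
      · ring
  obtain ⟨θ, ht1, ht2, hgap⟩ := perN N hNa (c N) hcN e δ he0.le he1 hδ hδ' (by linarith) hR
  have hrec := gen_recu N (c N) (g N) _ hcN (hg N hNa)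
  rw [hgap] at hrec
  rw [div_le_iff₀ hNpos] at ht1
  rw [le_div_iff₀ hNpos] at ht2
  rw [Finset.mem_Icc] at hx
  have hcore := core N (by omega) _ _ e θ (fun k => abs_nonneg _) he0.le he1
    (by
      by_contra hh
      push Not at hh
      nlinarith) (by linarith) hR hrec (by simpa using hg1 N hNa) (x-1) (by omega)
  simp only [show x - 1 + 1 = x by omega] at hcore
  have hxc : ((x - 1 : ℕ) : ℝ) + 1/2 = x - 1/2 := by
    rw [Nat.cast_sub hx.1]; push_cast; ring
  rw [hxc] at hcore
  have hx1 : (1:ℝ) ≤ x := by exact_mod_cast hx.1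
  have hx2 : (x:ℝ) ≤ N := by exact_mod_cast hx.2
  have hlip : |Real.cos (θ * (x - 1/2)) - hfun N x| ≤ δ := by
    rw [hfun]
    have h1 : |Real.cos (θ * (x - 1/2)) - Real.cos (Real.pi * ((x : ℝ) - 1/2) / N)| ≤
        |θ * (x - 1/2) - Real.pi * ((x : ℝ) - 1/2) / N| := by
      exact Real.abs_cos_sub_cos_le _ _
    refine h1.trans ?_
    have h2 : θ * (x - 1/2) - Real.pi * ((x : ℝ) - 1/2) / N =
        (θ * N - Real.pi) * ((x - 1/2) / N) := by field_simp
    rw [h2, abs_mul]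
    have h3 : |θ * N - Real.pi| ≤ δ := abs_le.2 ⟨by linarith, by linarith⟩
    have h4 : |((x:ℝ) - 1/2) / N| ≤ 1 := by
      rw [abs_of_nonneg (div_nonneg (by linarith) hNpos.le), div_le_one hNpos]; linarith
    calc _ ≤ δ * 1 := mul_le_mul h3 h4 (abs_nonneg _) hδ.le
      _ = δ := mul_one _
  have := abs_sub_le (g N x) (Real.cos (θ * (x - 1/2))) (hfun N x)
  linarith
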